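/- Let k ≥ 3, 1 ≤ ℓ < k/2, and let constants satisfy 1/n ≪ β ≪ μ ≪ 1/k. Let H be a k-graph on n vertices with a partition 𝒫 = {V₁, V₂, U} of V(H) such that V₁ and V₂ are each (β, 2)-closed in H, and suppose (a, k−a) is a μ-robust edge-vector of H − U for some 1 ≤ a ≤ k−1. Set m := a if a ≤ k/2 and m := a − ℓ + 1 otherwise, and let 𝒮 be the family of (k−ℓ)-sets S with i_𝒫(S) ∈ {(m, k−ℓ−m), (m−1, k−ℓ−m+1)}. Then there exists b = (4k−2ℓ−1)(k−ℓ) + r for some r ≤ k⁴ such that for every S ∈ 𝒮, H contains at least β^{k−ℓ+1}·n^b/2 S-absorbers, each of which is a b-tuple of distinct vertices avoiding S that spans a family of 2k−2ℓ+1 vertex-disjoint ℓ-paths. -/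

import Mathlib

/-- `H` is a `k`-uniform hypergraph (a `k`-graph) on the vertex set `Fin n`. -/
def IsKGraph (n k : ℕ) (H : Finset (Finset (Fin n))) : Prop :=
  ∀ e ∈ H, e.card = k

/-- The degree `deg_H(S)` of a vertex set `S` in the `k`-graph `H`: the number of
`(k - |S|)`-sets `T` disjoint from `S` with `S ∪ T ∈ H`. -/
noncomputable def hDeg (n k : ℕ) (H : Finset (Finset (Fin n))) (S : Finset (Fin n)) : ℕ :=
  Nat.card {T : Finset (Fin n) // T.card = k - S.card ∧ Disjoint S T ∧ S ∪ T ∈ H}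

/-- The minimum `d`-degree `δ_d(H)` of a `k`-graph `H` on `Fin n`. -/
noncomputable def minDeg (n k d : ℕ) (H : Finset (Finset (Fin n))) : ℕ :=
  sInf { m : ℕ | ∃ S : Finset (Fin n), S.card = d ∧ hDeg n k H S = m }

/-- `H` contains a Hamilton `ℓ`-cycle: there is a cyclic ordering of all the vertices such
that the `n / (k - ℓ)` segments of `k` consecutive vertices starting at the positions
divisible by `k - ℓ` are all edges of `H` (hence every two consecutive edges share
exactly `ℓ` vertices). -/
def HasHamiltonCycle (n k l : ℕ) (H : Finset (Finset (Fin n))) : Prop :=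
  ∃ f : ZMod n → Fin n, Function.Bijective f ∧
    ∀ j < n / (k - l),
      ((Finset.range k).image (fun i => f ((j * (k - l) + i : ℕ) : ZMod n))) ∈ H

/-- `f` enumerates (the vertices, in order, of) an `ℓ`-path with `t` edges in `H`:
the `j`-th edge consists of the `k` consecutive vertices starting at position `j * (k - ℓ)`,
so every two consecutive edges share exactly `ℓ` vertices. -/
def IsLPath (n k l t : ℕ) (H : Finset (Finset (Fin n))) (f : ℕ → Fin n) : Prop :=
  Set.InjOn f (Set.Iio (t * (k - l) + l)) ∧
  ∀ j < t, ((Finset.range k).image (fun i => f (j * (k - l) + i))) ∈ H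

/-- The vertex set of the `ℓ`-path with `t` edges enumerated by `f`. -/
def pathVerts (n k l t : ℕ) (f : ℕ → Fin n) : Finset (Fin n) :=
  (Finset.range (t * (k - l) + l)).image f

/-- The first `ℓ` vertices (as an ordered `ℓ`-set) of the path enumerated by `f`. -/
def pathBeg (n l : ℕ) (f : ℕ → Fin n) : Fin l → Fin n := fun i => f (i : ℕ)

/-- The last `ℓ` vertices (as an ordered `ℓ`-set) of an `ℓ`-path with `t` edges
enumerated by `f`. -/
def pathEnd (n k l t : ℕ) (f : ℕ → Fin n) : Fin l → Fin n := fun i => f (t * (k - l) + (i : ℕ))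

/-- `T` is a reachable set for the pair `{u, v}` (with parameter `i`): there are
vertex-disjoint `ℓ`-paths `P₁, …, Pᵢ` of length two covering exactly `T ∪ {u}` and
vertex-disjoint `ℓ`-paths `P₁', …, Pᵢ'` of length two covering exactly `T ∪ {v}`,
where `P_j` and `P_j'` have the same (ordered) ends for all `j`. -/
def ReachSet (n k l i : ℕ) (H : Finset (Finset (Fin n))) (u v : Fin n)
    (T : Finset (Fin n)) : Prop :=
  ∃ P P' : Fin i → ℕ → Fin n,
    (∀ j, IsLPath n k l 2 H (P j)) ∧ (∀ j, IsLPath n k l 2 H (P' j)) ∧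
    (∀ j j', j ≠ j' → Disjoint (pathVerts n k l 2 (P j)) (pathVerts n k l 2 (P j'))) ∧
    (∀ j j', j ≠ j' → Disjoint (pathVerts n k l 2 (P' j)) (pathVerts n k l 2 (P' j'))) ∧
    (Finset.univ.biUnion (fun j => pathVerts n k l 2 (P j)) = insert u T) ∧
    (Finset.univ.biUnion (fun j => pathVerts n k l 2 (P' j)) = insert v T) ∧
    (∀ j, pathBeg n l (P j) = pathBeg n l (P' j) ∧
      pathEnd n k l 2 (P j) = pathEnd n k l 2 (P' j))

/-- `u` and `v` are `(β, i)`-reachable in the `k`-graph `H` on `n` vertices: there are at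
least `β * n ^ ((2k - ℓ) i - 1)` sets `T` of size `(2k - ℓ) i - 1` that are reachable sets
for `{u, v}`. -/
def Reachable (n k l : ℕ) (H : Finset (Finset (Fin n))) (β : ℝ) (i : ℕ) (u v : Fin n) : Prop :=
  β * (n : ℝ) ^ ((2 * k - l) * i - 1) ≤
    (Nat.card {T : Finset (Fin n) // T.card = (2 * k - l) * i - 1 ∧
      ReachSet n k l i H u v T} : ℝ)

/-- `H` contains a `Y_{k,2ℓ}`-tiling (vertex-disjoint copies of the `k`-graph consisting of
two edges intersecting in exactly `2ℓ` vertices) covering all but at most `u` vertices. -/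
def HasYTilingCover (n l : ℕ) (H : Finset (Finset (Fin n))) (u : ℝ) : Prop :=
  ∃ (m : ℕ) (e₁ e₂ : Fin m → Finset (Fin n)),
    (∀ j, e₁ j ∈ H ∧ e₂ j ∈ H ∧ ((e₁ j) ∩ (e₂ j)).card = 2 * l) ∧
    (∀ j j', j ≠ j' → Disjoint ((e₁ j) ∪ (e₂ j)) ((e₁ j') ∪ (e₂ j'))) ∧
    (n : ℝ) - ((Finset.univ.biUnion fun j => (e₁ j) ∪ (e₂ j)).card : ℝ) ≤ u

/-- The tiling threshold `t_d^ℓ(k, n, ε)`: the minimum `t` such that every `k`-graph `H`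
on `n` vertices with `δ_d(H) ≥ t` contains a `Y_{k,2ℓ}`-tiling covering all but at most
`ε n` vertices. -/
noncomputable def tThreshold (k d l n : ℕ) (ε : ℝ) : ℕ :=
  sInf { t : ℕ | ∀ H : Finset (Finset (Fin n)), IsKGraph n k H →
    t ≤ minDeg n k d H → HasYTilingCover n l H (ε * n) }

/-- `t(k,d,ℓ) := limsup_{ε → 0⁺} limsup_{n → ∞} t_d^ℓ(k,n,ε) / C(n, k-d)`. -/
noncomputable def tVal (k d l : ℕ) : ℝ :=
  Filter.limsup
    (fun ε : ℝ => Filter.limsup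
      (fun n : ℕ => (tThreshold k d l n ε : ℝ) / (n.choose (k - d) : ℝ)) Filter.atTop)
    (nhdsWithin (0 : ℝ) (Set.Ioi (0 : ℝ)))

/-- The Dirac threshold `h_d^ℓ(k, n)`: the smallest `h` such that every `k`-graph `H` on
`n` vertices with `δ_d(H) ≥ h` contains a Hamilton `ℓ`-cycle. -/
noncomputable def hThreshold (k d l n : ℕ) : ℕ :=
  sInf { h : ℕ | ∀ H : Finset (Finset (Fin n)), IsKGraph n k H →
    h ≤ minDeg n k d H → HasHamiltonCycle n k l H }

/-- `h_d^ℓ(k) := limsup_{n → ∞, (k-ℓ) ∣ n} h_d^ℓ(k,n) / C(n, k-d)`. -/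
noncomputable def hVal (k d l : ℕ) : ℝ :=
  Filter.limsup (fun n : ℕ => (hThreshold k d l n : ℝ) / (n.choose (k - d) : ℝ))
    (Filter.atTop ⊓ Filter.principal { m : ℕ | (k - l) ∣ m })

/-- The generalized binomial coefficient `C(x, r)` for a real `x`. -/
noncomputable def genChoose (x : ℝ) (r : ℕ) : ℝ :=
  (∏ i ∈ Finset.range r, (x - (i : ℝ))) / (r.factorial : ℝ)

/-- The number of sets in the `ε`-robust `r`-shadow `∂_ε^r(G)` of the `K`-graph `G` on
`Fin n`: the number of `(K - r)`-sets lying in more than `ε * n ^ r` edges of `G`. -/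
noncomputable def shadowCard (n K r : ℕ) (G : Finset (Finset (Fin n))) (ε : ℝ) : ℕ :=
  Nat.card {F : Finset (Fin n) // F.card = K - r ∧ ε * (n : ℝ) ^ r < (hDeg n K G F : ℝ)}

/-- `g` is an `S`-absorber, given as a `b`-tuple of distinct vertices avoiding `S`: the
tuple spans a family of `2k - 2ℓ + 1` vertex-disjoint `ℓ`-paths, and there is another
family of `2k - 2ℓ + 1` vertex-disjoint `ℓ`-paths, with the same ordered ends, spanning
the tuple together with `S`. -/
def IsAbsorberTuple (n k l b : ℕ) (H : Finset (Finset (Fin n))) (S : Finset (Fin n))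
    (g : Fin b → Fin n) : Prop :=
  Function.Injective g ∧ (∀ i, g i ∉ S) ∧
  ∃ (t t' : Fin (2 * k - 2 * l + 1) → ℕ) (Q Q' : Fin (2 * k - 2 * l + 1) → ℕ → Fin n),
    (∀ j, IsLPath n k l (t j) H (Q j)) ∧ (∀ j, IsLPath n k l (t' j) H (Q' j)) ∧
    (∀ j j', j ≠ j' → Disjoint (pathVerts n k l (t j) (Q j)) (pathVerts n k l (t j') (Q j'))) ∧
    (∀ j j', j ≠ j' →
      Disjoint (pathVerts n k l (t' j) (Q' j)) (pathVerts n k l (t' j') (Q' j'))) ∧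
    (∀ j, pathBeg n l (Q j) = pathBeg n l (Q' j) ∧
      pathEnd n k l (t j) (Q j) = pathEnd n k l (t' j) (Q' j)) ∧
    Finset.univ.biUnion (fun j => pathVerts n k l (t' j) (Q' j)) = Finset.image g Finset.univ ∧
    Finset.univ.biUnion (fun j => pathVerts n k l (t j) (Q j)) = Finset.image g Finset.univ ∪ S

/-- Split the positions of a path into blocks of length `M`. The first `l + 1` positions of the
blocks, read from left to right, spell a word; `wordPos l M y` is the position of its letter `y`. -/
def wordPos (l M y : ℕ) : ℕ := y / (l + 1) * M + y % (l + 1)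

/-- The colour of position `p`: letter `y` of the word gets `y % (2 * l + 1)`, while the other
`M - l - 1` positions of each block get the remaining colours in order. Each window of `M + l`
positions starting at a multiple of `M` is then rainbow. -/
def posColor (l M p : ℕ) : ℕ :=
  if p % M ≤ l then (p / M * (l + 1) + p % M) % (2 * l + 1) else l + p % M

/-- The positions, in order, of an `l`-path with `l` edges inside an `l`-path with `l + 1` edges
having the same ends: it walks the odd cycle of colour intervals the opposite way, so that its
edges are again rainbow for `posColor`. -/
def reroute (l M p : ℕ) : ℕ :=
  if p % M < l then
    wordPos l M (if p / M < l then p / M * l + p % M else p / M * l + p % M + (2 * l + 1))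
  else if p % M = l then wordPos l M (l * l + (p / M * l + l * l + 3 * l) % (2 * l + 1))
  else p

theorem block_div {M i : ℕ} (j : ℕ) (h : i < M) : (j * M + i) / M = j := by
  rw [mul_comm, Nat.mul_add_div (by omega), Nat.div_eq_of_lt h, add_zero]

theorem block_mod {M i : ℕ} (j : ℕ) (h : i < M) : (j * M + i) % M = i := by
  rw [mul_comm, Nat.mul_add_mod, Nat.mod_eq_of_lt h]

theorem wordPos_div {l M : ℕ} (h : l < M) (y : ℕ) : wordPos l M y / M = y / (l + 1) :=
  block_div _ (lt_of_lt_of_le (Nat.mod_lt _ (by omega)) h)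

theorem wordPos_mod {l M : ℕ} (h : l < M) (y : ℕ) : wordPos l M y % M = y % (l + 1) :=
  block_mod _ (lt_of_lt_of_le (Nat.mod_lt _ (by omega)) h)

theorem wordPos_mod_le {l M : ℕ} (h : l < M) (y : ℕ) : wordPos l M y % M ≤ l := by
  rw [wordPos_mod h]; exact Nat.le_of_lt_succ (Nat.mod_lt _ (by omega))

theorem wordPos_injective {l M : ℕ} (h : l < M) : Function.Injective (wordPos l M) := by
  intro x y hxy
  have h1 := wordPos_div h x
  have h2 := wordPos_mod h x
  rw [hxy, wordPos_div h] at h1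
  rw [hxy, wordPos_mod h] at h2
  rw [← Nat.div_add_mod x (l + 1), ← Nat.div_add_mod y (l + 1), h1, h2]

theorem wordPos_block {l M i : ℕ} (j : ℕ) (h : i ≤ l) :
    wordPos l M (j * (l + 1) + i) = j * M + i := by
  rw [wordPos, block_div _ (by omega), block_mod _ (by omega)]

theorem wordPos_lt {l M y : ℕ} (h : l < M) (hy : y < (l + 1) * (l + 1) + l) :
    wordPos l M y < (l + 1) * M + l := by
  have h1 := Nat.div_add_mod y (l + 1)
  have h2 : y % (l + 1) < l + 1 := Nat.mod_lt _ (by omega)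
  rw [wordPos]
  generalize y / (l + 1) = a at *
  generalize y % (l + 1) = b at *
  rcases lt_trichotomy a (l + 1) with ha | rfl | ha
  · have : (a + 1) * M ≤ (l + 1) * M := Nat.mul_le_mul_right _ ha
    rw [add_mul] at this
    omega
  · omega
  · have : (l + 1) * (l + 2) ≤ (l + 1) * a := Nat.mul_le_mul_left _ ha
    nlinarith

theorem posColor_wordPos {l M : ℕ} (h : l < M) (y : ℕ) :
    posColor l M (wordPos l M y) = y % (2 * l + 1) := by
  rw [posColor, if_pos (wordPos_mod_le h y), wordPos_div h, wordPos_mod h, mul_comm,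
    Nat.div_add_mod]

theorem posColor_lt {l M : ℕ} (h : l < M) (p : ℕ) : posColor l M p < M + l := by
  unfold posColor
  have := Nat.mod_lt p (show M > 0 by omega)
  split_ifs
  · exact lt_of_lt_of_le (Nat.mod_lt _ (by omega)) (by omega)
  · omega

theorem posColor_block {l M i : ℕ} (h : l < M) (j : ℕ) (hi : i < M + l) :
    posColor l M (j * M + i) =
      if i ≤ l then (j * (l + 1) + i) % (2 * l + 1)
      else if i < M then l + i
      else (j * (l + 1) + (l + 1) + (i - M)) % (2 * l + 1) := by
  by_cases h1 : i < M
  · rw [posColor, block_mod _ h1, block_div _ h1]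
    split_ifs <;> rfl
  · have : j * M + i = (j + 1) * M + (i - M) := by rw [add_mul]; omega
    rw [this, posColor, block_mod _ (by omega), block_div _ (by omega), if_pos (by omega),
      if_neg (by omega), if_neg h1, add_mul, one_mul]

theorem add_mod_inj {K a x y : ℕ} (hx : x < K) (hy : y < K) (h : (a + x) % K = (a + y) % K) :
    x = y := by
  have : x ≡ y [MOD K] := Nat.ModEq.add_left_cancel' a h
  exact Nat.ModEq.eq_of_lt_of_lt this hx hy

theorem posColor_injOn {l M : ℕ} (h : l < M) (j : ℕ) :
    Set.InjOn (fun i => posColor l M (j * M + i)) (Set.Iio (M + l)) := by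
  intro x hx y hy hxy
  simp only [Set.mem_Iio] at hx hy
  simp only [posColor_block h j hx, posColor_block h j hy, add_assoc] at hxy
  have hK : 0 < 2 * l + 1 := by omega
  have m1 := fun z => Nat.mod_lt (j * (l + 1) + z) hK
  have := m1 x
  have := m1 y
  have := m1 (l + (1 + (x - M)))
  have := m1 (l + (1 + (y - M)))
  split_ifs at hxy <;> first
    | omega
    | (have := add_mod_inj (by omega) (by omega) hxy; omega)

theorem posColor_reroute_block {l M i : ℕ} (h : l < M) (j : ℕ) (hi : i < M) :
    posColor l M (reroute l M (j * M + i)) =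
      if i < l then (j * l + i) % (2 * l + 1)
      else if i = l then (j * l + 2 * l) % (2 * l + 1) else l + i := by
  rw [reroute, block_mod _ hi, block_div _ hi]
  split_ifs with h1 h2 h3
  · rw [posColor_wordPos h]
  · rw [posColor_wordPos h, Nat.add_mod_right]
  · rw [posColor_wordPos h, Nat.add_mod_mod,
      show l * l + (j * l + l * l + 3 * l) = j * l + 2 * l + (2 * l + 1) * l by ring,
      Nat.add_mul_mod_self_left]
  · rw [posColor, block_mod _ hi, if_neg (by omega)]

theorem posColor_reroute_injOn {l M : ℕ} (h : l < M) (j : ℕ) :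
    Set.InjOn (fun i => posColor l M (reroute l M (j * M + i))) (Set.Iio (M + l)) := by
  have key : ∀ i < M + l, posColor l M (reroute l M (j * M + i)) =
      if i < l then (j * l + i) % (2 * l + 1)
      else if i = l then (j * l + 2 * l) % (2 * l + 1)
      else if i < M then l + i else (j * l + (l + (i - M))) % (2 * l + 1) := by
    intro i hi
    by_cases h1 : i < M
    · rw [posColor_reroute_block h j h1, if_pos h1]
    · have : j * M + i = (j + 1) * M + (i - M) := by rw [add_mul]; omega
      rw [this, posColor_reroute_block h _ (by omega), if_pos (by omega), if_neg (by omega),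
        if_neg (by omega), if_neg h1, add_mul, one_mul, add_assoc]
  intro x hx y hy hxy
  simp only [Set.mem_Iio] at hx hy
  simp only [key x hx, key y hy] at hxy
  have hK : 0 < 2 * l + 1 := by omega
  have m1 := fun z => Nat.mod_lt (j * l + z) hK
  have := m1 x
  have := m1 y
  have := m1 (2 * l)
  have := m1 (l + (x - M))
  have := m1 (l + (y - M))
  split_ifs at hxy <;> first
    | omega
    | (have := add_mod_inj (by omega) (by omega) hxy; omega)

theorem reroute_beg {l M i : ℕ} (h : l < M) (hi : i < l) : reroute l M i = i := by
  have h1 : i % M = i := Nat.mod_eq_of_lt (by omega)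
  have h2 : i / M = 0 := Nat.div_eq_of_lt (by omega)
  rw [reroute, h1, h2, if_pos hi, if_pos (by omega), wordPos, zero_mul, zero_add,
    Nat.div_eq_of_lt (by omega), Nat.mod_eq_of_lt (by omega), zero_mul, zero_add]

theorem reroute_end {l M i : ℕ} (h : l < M) (hi : i < l) :
    reroute l M (l * M + i) = (l + 1) * M + i := by
  rw [reroute, block_mod _ (by omega), block_div _ (by omega), if_pos hi, if_neg (by omega),
    show l * l + i + (2 * l + 1) = (l + 1) * (l + 1) + i by ring, wordPos_block _ hi.le]

theorem exists_block {l M p : ℕ} (h : l < M) (hp : p < l * M + l) :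
    ∃ j i, p = j * M + i ∧ i < M ∧ (j < l ∨ j = l ∧ i < l) := by
  have h1 := Nat.div_add_mod' p M
  have h2 := Nat.mod_lt p (show M > 0 by omega)
  refine ⟨p / M, p % M, h1.symm, h2, ?_⟩
  generalize p / M = a at *
  generalize p % M = b at *
  rcases lt_trichotomy a l with ha | rfl | ha
  · exact Or.inl ha
  · right; omega
  · have : (l + 1) * M ≤ a * M := Nat.mul_le_mul_right _ ha
    rw [add_mul] at this
    omega

theorem reroute_mapsTo {l M : ℕ} (h : l < M) :
    Set.MapsTo (reroute l M) (Set.Iio (l * M + l)) (Set.Iio ((l + 1) * M + l)) := by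
  intro p hp
  simp only [Set.mem_Iio] at hp ⊢
  obtain ⟨j, i, rfl, hi, hj⟩ := exists_block h hp
  have hm := Nat.mod_lt (j * l + l * l + 3 * l) (show 2 * l + 1 > 0 by omega)
  have h1 : j * l ≤ l * l := Nat.mul_le_mul_right _ (by omega)
  rw [reroute, block_mod _ hi, block_div _ hi]
  split_ifs with h2 h3
  · exact wordPos_lt h (by nlinarith)
  · exact wordPos_lt h (by nlinarith)
  · exact wordPos_lt h (by nlinarith)
  · rw [add_mul]; omega

theorem block_unique {m i i' j j' : ℕ} (hi : i < m) (hi' : i' < m)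
    (h : j * m + i = j' * m + i') : j = j' ∧ i = i' := by
  have h1 := block_div j hi
  have h2 := block_mod j hi
  rw [h, block_div _ hi'] at h1
  rw [h, block_mod _ hi'] at h2
  exact ⟨h1.symm, h2.symm⟩

theorem mul_add_mod_inj {l j j' x : ℕ} (hj : j < 2 * l + 1) (hj' : j' < 2 * l + 1)
    (h : (j * l + x) % (2 * l + 1) = (j' * l + x) % (2 * l + 1)) : j = j' := by
  have h1 : j * l ≡ j' * l [MOD (2 * l + 1)] := Nat.ModEq.add_right_cancel' x h
  have h2 : Nat.gcd (2 * l + 1) l = 1 := by simp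
  exact Nat.ModEq.eq_of_lt_of_lt (Nat.ModEq.cancel_right_of_coprime h2 h1) hj hj'

theorem reroute_injOn {l M : ℕ} (h : l < M) :
    Set.InjOn (reroute l M) (Set.Iio (l * M + l)) := by
  intro p hp p' hp' hpp
  simp only [Set.mem_Iio] at hp hp'
  obtain ⟨j, i, rfl, hi, hj⟩ := exists_block h hp
  obtain ⟨j', i', rfl, hi', hj'⟩ := exists_block h hp'
  have hm := Nat.mod_lt (j * l + l * l + 3 * l) (show 2 * l + 1 > 0 by omega)
  have hm' := Nat.mod_lt (j' * l + l * l + 3 * l) (show 2 * l + 1 > 0 by omega)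
  have small : ∀ {a b : ℕ}, a < l → b < l → a * l + b < l * l := by
    intro a b ha hb
    have := Nat.mul_le_mul_right l (show a + 1 ≤ l from ha)
    rw [add_mul] at this
    omega
  have clash : ∀ {y q : ℕ}, wordPos l M y = q → ¬ l < q % M := by
    rintro y q rfl
    have := wordPos_mod_le h y
    omega
  have e1 := block_mod j hi
  have e2 := block_mod j' hi'
  simp only [reroute, block_mod _ hi, block_div _ hi, block_mod _ hi', block_div _ hi'] at hpp
  suffices hs : j = j' ∧ i = i' by rw [hs.1, hs.2]
  by_cases a1 : i < l
  · rw [if_pos a1] at hpp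
    by_cases b1 : i' < l
    · rw [if_pos b1] at hpp
      have hpp := wordPos_injective h hpp
      by_cases c : j < l <;> by_cases d : j' < l
      · rw [if_pos c, if_pos d] at hpp
        exact block_unique a1 b1 hpp
      · rw [if_pos c, if_neg d] at hpp
        have := small c a1
        obtain rfl : j' = l := by omega
        omega
      · rw [if_neg c, if_pos d] at hpp
        have := small d b1
        obtain rfl : j = l := by omega
        omega
      · rw [if_neg c, if_neg d] at hpp
        exact block_unique a1 b1 (by omega)
    · rw [if_neg b1] at hpp
      by_cases b2 : i' = l
      · rw [if_pos b2] at hpp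
        have hpp := wordPos_injective h hpp
        by_cases c : j < l
        · rw [if_pos c] at hpp
          have := small c a1
          omega
        · obtain rfl : j = l := by omega
          rw [if_neg c] at hpp
          omega
      · rw [if_neg b2] at hpp
        exact absurd (by omega) (clash hpp)
  · rw [if_neg a1] at hpp
    by_cases a2 : i = l
    · rw [if_pos a2] at hpp
      by_cases b1 : i' < l
      · rw [if_pos b1] at hpp
        have hpp := wordPos_injective h hpp
        by_cases d : j' < l
        · rw [if_pos d] at hpp
          have := small d b1
          omega
        · obtain rfl : j' = l := by omega
          rw [if_neg d] at hpp
          omega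
      · rw [if_neg b1] at hpp
        by_cases b2 : i' = l
        · rw [if_pos b2] at hpp
          have hpp := wordPos_injective h hpp
          refine ⟨?_, by omega⟩
          simp only [add_assoc, Nat.add_left_cancel_iff] at hpp
          exact mul_add_mod_inj (by omega) (by omega) hpp
        · rw [if_neg b2] at hpp
          exact absurd (by omega) (clash hpp)
    · rw [if_neg a2] at hpp
      by_cases b1 : i' < l
      · rw [if_pos b1] at hpp
        exact absurd (by omega) (clash hpp.symm)
      · rw [if_neg b1] at hpp
        by_cases b2 : i' = l
        · rw [if_pos b2] at hpp
          exact absurd (by omega) (clash hpp.symm)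
        · rw [if_neg b2] at hpp
          exact block_unique hi hi' hpp

theorem leftover_cases {l M p : ℕ} (h : l < M) (hp : p < (l + 1) * M + l)
    (hout : ∀ q < l * M + l, reroute l M q ≠ p) :
    (∃ x < 2 * l + 1, p = wordPos l M (l * l + x)) ∨ ∃ i, l < i ∧ i < M ∧ p = l * M + i := by
  have h1 := Nat.div_add_mod' p M
  have h2 := Nat.mod_lt p (show M > 0 by omega)
  generalize p / M = j at *
  generalize p % M = i at *
  subst h1
  have hj : j ≤ l + 1 := by
    by_contra hc
    have : (l + 2) * M ≤ j * M := Nat.mul_le_mul_right _ (by omega)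
    nlinarith
  by_cases hil : i ≤ l
  · left
    have hw := wordPos_block (M := M) j hil
    rw [← hw]
    have hy : j * (l + 1) + i < l * l + (2 * l + 1) + l := by
      rcases Nat.lt_or_ge j (l + 1) with h3 | h3
      · have := Nat.mul_le_mul_right (l + 1) (show j + 1 ≤ l + 1 from h3)
        nlinarith
      · obtain rfl : j = l + 1 := by omega
        nlinarith
    rw [← hw] at hout
    generalize j * (l + 1) + i = y at *
    rcases Nat.lt_or_ge y (l * l) with h3 | h3
    · exfalso
      have hl : 0 < l := by
        rcases Nat.eq_zero_or_pos l with rfl | h4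
        · omega
        · exact h4
      have hd : y / l < l := Nat.div_lt_of_lt_mul h3
      have hm := Nat.mod_lt y hl
      apply hout (y / l * M + y % l)
      · have := Nat.mul_le_mul_right M (show y / l + 1 ≤ l from hd)
        rw [add_mul] at this
        omega
      · rw [reroute, block_mod _ (by omega), block_div _ (by omega), if_pos hm, if_pos hd,
          Nat.div_add_mod']
    · rcases Nat.lt_or_ge y (l * l + (2 * l + 1)) with h4 | h4
      · exact ⟨y - l * l, by omega, by congr 1; omega⟩
      · exfalso
        apply hout (l * M + (y - (l * l + (2 * l + 1)))) (by omega)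
        rw [reroute, block_mod _ (by omega), block_div _ (by omega), if_pos (by omega),
          if_neg (by omega)]
        congr 1
        omega
  · right
    refine ⟨i, by omega, h2, ?_⟩
    rcases lt_trichotomy j l with h3 | rfl | h3
    · exfalso
      apply hout (j * M + i)
      · have := Nat.mul_le_mul_right M (show j + 1 ≤ l from h3)
        rw [add_mul] at this
        omega
      · rw [reroute, block_mod _ h2, if_neg (by omega), if_neg (by omega)]
    · rfl
    · exfalso
      obtain rfl : j = l + 1 := by omega
      omega

theorem posColor_leftover_injOn {l M : ℕ} (h : l < M) :
    Set.InjOn (posColor l M)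
      {p | p < (l + 1) * M + l ∧ ∀ q < l * M + l, reroute l M q ≠ p} := by
  have hext : ∀ i, l < i → i < M → posColor l M (l * M + i) = l + i := by
    intro i h1 h2
    rw [posColor, block_mod _ h2, if_neg (by omega)]
  rintro p ⟨hp, hp'⟩ q ⟨hq, hq'⟩ hpq
  rcases leftover_cases h hp hp' with ⟨x, hx, rfl⟩ | ⟨i, hi, hi', rfl⟩ <;>
  rcases leftover_cases h hq hq' with ⟨y, hy, rfl⟩ | ⟨i', h3, h4, rfl⟩
  · rw [posColor_wordPos h, posColor_wordPos h] at hpq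
    rw [add_mod_inj hx hy hpq]
  · rw [posColor_wordPos h, hext _ h3 h4] at hpq
    have := Nat.mod_lt (l * l + x) (show 2 * l + 1 > 0 by omega)
    omega
  · rw [posColor_wordPos h, hext _ hi hi'] at hpq
    have := Nat.mod_lt (l * l + y) (show 2 * l + 1 > 0 by omega)
    omega
  · rw [hext _ hi hi', hext _ h3 h4] at hpq
    omega

theorem card_tuples_ge {X Y Q : Type} [Fintype X] [Fintype Y] [Fintype Q]
    (R : X → Y → Prop) {p : ℝ} (hp : 0 ≤ p)
    (h : p * Fintype.card X * Fintype.card Y ≤ Nat.card {z : X × Y // R z.1 z.2}) :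
    p ^ Fintype.card Q * (Fintype.card X : ℝ) ^ Fintype.card Q * Fintype.card Y ≤
      Nat.card {z : (Q → X) × Y // ∀ q, R (z.1 q) z.2} := by
  classical
  have e1 : {z : X × Y // R z.1 z.2} ≃ Σ y, {x // R x y} :=
    { toFun := fun z => ⟨z.1.2, z.1.1, z.2⟩
      invFun := fun z => ⟨(z.2.1, z.1), z.2.2⟩
      left_inv := fun _ => rfl
      right_inv := fun _ => rfl }
  have e2 : {z : (Q → X) × Y // ∀ q, R (z.1 q) z.2} ≃ Σ y, (Q → {x // R x y}) :=
    { toFun := fun z => ⟨z.1.2, fun q => ⟨z.1.1 q, z.2 q⟩⟩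
      invFun := fun z => ⟨(fun q => (z.2 q).1, z.1), fun q => (z.2 q).2⟩
      left_inv := fun _ => rfl
      right_inv := fun _ => rfl }
  rw [Nat.card_congr e1, Nat.card_sigma] at h
  rw [Nat.card_congr e2, Nat.card_sigma]
  simp only [Nat.card_fun, Nat.card_eq_fintype_card (α := Q)] at h ⊢
  push_cast at h ⊢
  rcases Nat.eq_zero_or_eq_succ_pred (Fintype.card Q) with hq | hq
  · simp [hq]
  rcases Nat.eq_zero_or_pos (Fintype.card Y) with hy | hy
  · rw [hy]
    simp only [Nat.cast_zero, mul_zero]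
    positivity
  rw [hq]
  generalize (Fintype.card Q).pred = q
  have hnonneg : ∀ y ∈ (Finset.univ : Finset Y), (0 : ℝ) ≤ Nat.card {x // R x y} :=
    fun _ _ => Nat.cast_nonneg _
  have hy' : (0 : ℝ) < Fintype.card Y := by exact_mod_cast hy
  refine le_trans ?_ (pow_sum_div_card_le_sum_pow hnonneg q)
  rw [Finset.card_univ, le_div_iff₀ (by positivity)]
  calc _ = (p * Fintype.card X * Fintype.card Y : ℝ) ^ (q + 1) := by
        rw [Nat.succ_eq_add_one]; ring
    _ ≤ _ := pow_le_pow_left₀ (by positivity) h _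

/-- Supersaturation: a dense `k`-ary relation has positive density of complete blow-ups. -/
theorem blowup_count {X Q : Type} [Fintype X] [Fintype Q] (k : ℕ) :
    ∀ (Y : Type) [Fintype Y] (R : (Fin k → X) → Y → Prop) (p : ℝ), 0 ≤ p →
      p * (Fintype.card X : ℝ) ^ k * Fintype.card Y ≤
        Nat.card {z : (Fin k → X) × Y // R z.1 z.2} →
      p ^ (Fintype.card Q ^ k) * ((Fintype.card X : ℝ) ^ Fintype.card Q) ^ k * Fintype.card Y ≤
        Nat.card {z : (Fin k → Q → X) × Y //
          ∀ τ : Fin k → Q, R (fun j => z.1 j (τ j)) z.2} := by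
  classical
  induction k with
  | zero =>
    intro Y _ R p hp h
    simp only [pow_zero, pow_one, mul_one] at h ⊢
    refine h.trans (le_of_eq ?_)
    congr 1
    refine Nat.card_congr (Equiv.subtypeEquiv
      (Equiv.prodCongr (Equiv.ofUnique _ _) (Equiv.refl Y)) ?_)
    rintro ⟨f, y⟩
    simp only [Equiv.prodCongr_apply, Prod.map, Equiv.refl_apply]
    constructor
    · intro h τ
      convert h
    · intro h
      convert h finZeroElim
  | succ k ih =>
    intro Y _ R p hp h
    have e1 : {z : (Fin (k + 1) → X) × Y // R z.1 z.2} ≃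
        {z : X × ((Fin k → X) × Y) // R (Fin.cons z.1 z.2.1) z.2.2} :=
      Equiv.subtypeEquiv
        (((Fin.consEquiv fun _ => X).symm.prodCongr (Equiv.refl Y)).trans
          (Equiv.prodAssoc _ _ _)) (by
        rintro ⟨f, y⟩
        simp)
    have e2 : {z : (Fin (k + 1) → Q → X) × Y //
          ∀ τ : Fin (k + 1) → Q, R (fun j => z.1 j (τ j)) z.2} ≃
        {z : (Fin k → Q → X) × ((Q → X) × Y) // ∀ τ : Fin k → Q, ∀ q,
          R (Fin.cons (z.2.1 q) fun j => z.1 j (τ j)) z.2.2} :=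
      Equiv.subtypeEquiv
        { toFun := fun z => (Fin.tail z.1, z.1 0, z.2)
          invFun := fun z => (Fin.cons z.2.1 z.1, z.2.2)
          left_inv := fun z => by simp
          right_inv := fun z => by simp } (by
        rintro ⟨f, y⟩
        simp only [Equiv.coe_fn_mk]
        constructor
        · intro h τ q
          convert h (Fin.cons q τ) using 1
          funext j
          refine Fin.cases ?_ (fun i => ?_) j <;> simp [Fin.tail]
        · intro h τ
          convert h (Fin.tail τ) (τ 0) using 1
          funext j
          refine Fin.cases ?_ (fun i => ?_) j <;> simp [Fin.tail])
    rw [Nat.card_congr e1] at h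
    rw [Nat.card_congr e2]
    have h1 := card_tuples_ge (Q := Q)
      (fun (x : X) (w : (Fin k → X) × Y) => R (Fin.cons x w.1) w.2) hp (by
        refine le_trans (le_of_eq ?_) h
        simp only [Fintype.card_prod, Fintype.card_fun, Fintype.card_fin]
        push_cast
        ring)
    have e3 : {z : (Q → X) × ((Fin k → X) × Y) // ∀ q, R (Fin.cons (z.1 q) z.2.1) z.2.2} ≃
        {z : (Fin k → X) × ((Q → X) × Y) // ∀ q, R (Fin.cons (z.2.1 q) z.1) z.2.2} :=
      Equiv.subtypeEquiv
        { toFun := fun z => (z.2.1, z.1, z.2.2)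
          invFun := fun z => (z.2.1, z.1, z.2.2)
          left_inv := fun _ => rfl
          right_inv := fun _ => rfl } (fun _ => Iff.rfl)
    rw [Nat.card_congr e3] at h1
    have h2 := ih ((Q → X) × Y) (fun x w => ∀ q, R (Fin.cons (w.1 q) x) w.2)
      (p ^ Fintype.card Q) (by positivity) (by
        refine le_trans (le_of_eq ?_) h1
        simp only [Fintype.card_prod, Fintype.card_fun, Fintype.card_fin]
        push_cast
        ring)
    refine le_trans (le_of_eq ?_) h2
    simp only [Fintype.card_prod, Fintype.card_fun]
    push_cast
    rw [← pow_mul p, ← pow_succ']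
    ring

theorem card_determined_coord_le {ι X : Type} [Fintype ι] [Fintype X] (i : ι)
    (F : ({x // x ≠ i} → X) → X) :
    Nat.card {g : ι → X // g i = F fun x => g x} ≤ Fintype.card X ^ (Fintype.card ι - 1) := by
  classical
  have : Fintype.card X ^ (Fintype.card ι - 1) = Nat.card ({x // x ≠ i} → X) := by
    rw [Nat.card_fun, Nat.card_eq_fintype_card, Nat.card_eq_fintype_card,
      Fintype.card_subtype_compl, Fintype.card_subtype_eq]
  rw [this]
  refine Nat.card_le_card_of_injective
    (fun (g : {g : ι → X // g i = F fun x => g x}) (x : {x // x ≠ i}) => g.1 x) ?_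
  rintro ⟨g, hg⟩ ⟨g', hg'⟩ h
  simp only at h
  have hx : ∀ x, x ≠ i → g x = g' x := fun x hx => congrFun h ⟨x, hx⟩
  ext x
  by_cases hxi : x = i
  · change g x = g' x
    rw [hxi, hg, hg', h]
  · exact hx x hxi

theorem card_not_injective_or_meets_le {ι X : Type} [Fintype ι] [Fintype X] (S : Finset X) :
    Nat.card {g : ι → X // ¬ (Function.Injective g ∧ ∀ i, g i ∉ S)} ≤
      (Fintype.card ι ^ 2 + Fintype.card ι * S.card) *
        Fintype.card X ^ (Fintype.card ι - 1) := by
  classical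
  let B : (ι × ι) ⊕ (ι × S) → Finset (ι → X) := Sum.elim
    (fun z => Finset.univ.filter fun g => z.1 ≠ z.2 ∧ g z.1 = g z.2)
    (fun z => Finset.univ.filter fun g => g z.1 = z.2)
  have hB : ∀ z, (B z).card ≤ Fintype.card X ^ (Fintype.card ι - 1) := by
    rintro (⟨i, j⟩ | ⟨i, s⟩)
    · by_cases hij : i = j
      · simp [B, hij]
      · have := card_determined_coord_le (X := X) i (fun g => g ⟨j, fun h => hij h.symm⟩)
        rw [Nat.card_eq_fintype_card, Fintype.card_subtype] at this
        simpa [B, hij] using this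
    · have := card_determined_coord_le (X := X) i (fun _ => s)
      rw [Nat.card_eq_fintype_card, Fintype.card_subtype] at this
      simpa [B] using this
  rw [Nat.card_eq_fintype_card, Fintype.card_subtype]
  calc _ ≤ (Finset.univ.biUnion B).card := by
        refine Finset.card_le_card fun g hg => ?_
        simp only [Finset.mem_filter, Finset.mem_univ, true_and, not_and_or, not_forall,
          not_not] at hg
        simp only [Finset.mem_biUnion, Finset.mem_univ, true_and]
        rcases hg with hg | ⟨i, hi⟩
        · simp only [Function.Injective, not_forall] at hg
          obtain ⟨i, j, h1, h2⟩ := hg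
          exact ⟨Sum.inl (i, j), by simp [B, h1, h2]⟩
        · exact ⟨Sum.inr (i, ⟨g i, hi⟩), by simp [B]⟩
    _ ≤ _ := by
        refine (Finset.card_biUnion_le_card_mul _ _ _ fun z _ => hB z).trans (le_of_eq ?_)
        simp [sq]

/-- For a dense `k`-ary relation `R`, a positive proportion of the maps from a `k`-coloured set
send all rainbow `k`-tuples into `R`. -/
theorem card_partite_homs_ge {I X : Type} [Fintype I] [Fintype X] [Nonempty X] {k : ℕ}
    (c : I → Fin k) (R : (Fin k → X) → Prop) {p : ℝ} (hp : 0 ≤ p)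
    (h : p * (Fintype.card X : ℝ) ^ k ≤ Nat.card {x : Fin k → X // R x}) :
    p ^ (Fintype.card I ^ k) * (Fintype.card X : ℝ) ^ Fintype.card I ≤
      Nat.card {φ : I → X // ∀ σ : Fin k → I, (∀ j, c (σ j) = j) → R (φ ∘ σ)} := by
  classical
  have h1 := blowup_count (Q := I) k Unit (fun x _ => R x) p hp (by
    have e : {z : (Fin k → X) × Unit // R z.1} ≃ {x // R x} :=
      Equiv.subtypeEquiv (Equiv.prodPUnit (Fin k → X)) fun _ => Iff.rfl
    rw [Nat.card_congr e]
    simpa using h)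
  let J := {z : Fin k × I // z.1 ≠ c z.2}
  have hJ : Fintype.card J + Fintype.card I = k * Fintype.card I := by
    have e : {z : Fin k × I // z.1 = c z.2} ≃ I :=
      { toFun := fun z => z.1.2
        invFun := fun x => ⟨(c x, x), rfl⟩
        left_inv := by rintro ⟨⟨a, b⟩, hz⟩; simp only at hz; subst hz; rfl
        right_inv := fun _ => rfl }
    have h2 := Fintype.card_subtype_compl (fun z : Fin k × I => z.1 = c z.2)
    have h3 := Fintype.card_subtype_le (fun z : Fin k × I => z.1 = c z.2)
    rw [Fintype.card_congr e, Fintype.card_prod, Fintype.card_fin] at h2 h3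
    simp only [J, ne_eq]
    omega
  have h2 : Nat.card {z : (Fin k → I → X) × Unit //
        ∀ τ : Fin k → I, R (fun j => z.1 j (τ j))} ≤
      Nat.card ({φ : I → X // ∀ σ : Fin k → I, (∀ j, c (σ j) = j) → R (φ ∘ σ)} × (J → X)) := by
    refine Nat.card_le_card_of_injective (fun z =>
      (⟨fun x => z.1.1 (c x) x, fun σ hσ => ?_⟩, fun w => z.1.1 w.1.1 w.1.2)) ?_
    · have := z.2 σ
      convert this using 1
      funext j
      simp [hσ]
    · rintro ⟨⟨f, u⟩, hf⟩ ⟨⟨f', u'⟩, hf'⟩ heq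
      simp only [Prod.mk.injEq, Subtype.mk.injEq] at heq ⊢
      refine ⟨?_, trivial⟩
      funext j x
      by_cases hj : j = c x
      · rw [hj]; exact congrFun heq.1 x
      · exact congrFun heq.2 ⟨(j, x), hj⟩
  rw [Nat.card_prod, Nat.card_fun, Nat.card_eq_fintype_card (α := J),
    Nat.card_eq_fintype_card (α := X)] at h2
  have h3 := h1.trans (Nat.cast_le.mpr h2)
  have hX : (0 : ℝ) < Fintype.card X := by exact_mod_cast Fintype.card_pos
  rw [← pow_mul, mul_comm (Fintype.card I) k, ← hJ, add_comm, pow_add, Fintype.card_unit] at h3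
  push_cast at h3
  rw [mul_one, ← mul_assoc] at h3
  exact le_of_mul_le_mul_right h3 (by positivity)

theorem option_family_disjoint_and_union {α ι κ : Type*} [DecidableEq α] [Fintype ι] [Fintype κ]
    (F : Finset α) (W : ι → κ → Finset α) (X : ι → Finset α)
    (hW : ∀ i, Finset.univ.biUnion (W i) = X i)
    (hdisj : ∀ i x x', x ≠ x' → Disjoint (W i x) (W i x'))
    (hX : ∀ i i', i ≠ i' → Disjoint (X i) (X i')) (hF : ∀ i, Disjoint F (X i)) :
    (∀ o o' : Option (ι × κ), o ≠ o' →
      Disjoint (o.elim F fun z => W z.1 z.2) (o'.elim F fun z => W z.1 z.2)) ∧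
    Finset.univ.biUnion (fun o : Option (ι × κ) => o.elim F fun z => W z.1 z.2) =
      F ∪ Finset.univ.biUnion X := by
  have hsub : ∀ i x, W i x ⊆ X i := fun i x => by
    rw [← hW i]; exact Finset.subset_biUnion_of_mem (W i) (Finset.mem_univ x)
  constructor
  · rintro (_ | ⟨i, x⟩) (_ | ⟨i', x'⟩) ho
    · exact absurd rfl ho
    · exact (hF i').mono_right (hsub i' x')
    · exact ((hF i).mono_right (hsub i x)).symm
    · by_cases hi : i = i'
      · subst hi
        exact hdisj i x x' (fun h => ho (by rw [h]))
      · exact (hX i i' hi).mono (hsub i x) (hsub i' x')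
  · ext y
    simp only [Finset.mem_biUnion, Finset.mem_univ, true_and, Finset.mem_union, ← hW]
    constructor
    · rintro ⟨_ | ⟨i, x⟩, h⟩
      · exact Or.inl h
      · exact Or.inr ⟨i, x, h⟩
    · rintro (h | ⟨i, x, h⟩)
      · exact ⟨none, h⟩
      · exact ⟨some (i, x), h⟩

theorem isAbsorberTuple_of_reachSets {n k l b t t' : ℕ} {H : Finset (Finset (Fin n))}
    {S : Finset (Fin n)} {g : Fin b → Fin n} (hlk : l ≤ k) (hg : Function.Injective g)
    (hgS : ∀ i, g i ∉ S) {u v : Fin (k - l) → Fin n} {T : Fin (k - l) → Finset (Fin n)}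
    (hreach : ∀ i, ReachSet n k l 2 H (u i) (v i) (T i)) {f f' : ℕ → Fin n}
    (hf : IsLPath n k l t H f) (hf' : IsLPath n k l t' H f')
    (hbeg : pathBeg n l f = pathBeg n l f') (hend : pathEnd n k l t f = pathEnd n k l t' f')
    (hu : ∀ i i', i ≠ i' → Disjoint (insert (u i) (T i)) (insert (u i') (T i')))
    (hv : ∀ i i', i ≠ i' → Disjoint (insert (v i) (T i)) (insert (v i') (T i')))
    (hfu : ∀ i, Disjoint (pathVerts n k l t f) (insert (u i) (T i)))
    (hfv : ∀ i, Disjoint (pathVerts n k l t' f') (insert (v i) (T i)))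
    (hunion' : pathVerts n k l t' f' ∪ Finset.univ.biUnion (fun i => insert (v i) (T i)) =
      Finset.image g Finset.univ)
    (hunion : pathVerts n k l t f ∪ Finset.univ.biUnion (fun i => insert (u i) (T i)) =
      Finset.image g Finset.univ ∪ S) :
    IsAbsorberTuple n k l b H S g := by
  choose P P' hP hP' hPd hPd' hPu hPv hends using hreach
  have e : Fin (2 * k - 2 * l + 1) ≃ Option (Fin (k - l) × Fin 2) :=
    Fintype.equivOfCardEq (by simp; omega)
  obtain ⟨d1, un1⟩ := option_family_disjoint_and_union (pathVerts n k l t f)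
    (fun i x => pathVerts n k l 2 (P i x)) _ hPu hPd hu hfu
  obtain ⟨d2, un2⟩ := option_family_disjoint_and_union (pathVerts n k l t' f')
    (fun i x => pathVerts n k l 2 (P' i x)) _ hPv hPd' hv hfv
  have hverts : ∀ (s : ℕ) (f₀ : ℕ → Fin n) (P₀ : Fin (k - l) → Fin 2 → ℕ → Fin n)
      (o : Option (Fin (k - l) × Fin 2)),
      pathVerts n k l (o.elim s fun _ => 2) (o.elim f₀ fun z => P₀ z.1 z.2) =
        o.elim (pathVerts n k l s f₀) fun z => pathVerts n k l 2 (P₀ z.1 z.2) := by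
    rintro s f₀ P₀ (_ | _) <;> rfl
  have hbi : ∀ A : Option (Fin (k - l) × Fin 2) → Finset (Fin n),
      Finset.univ.biUnion (fun j => A (e j)) = Finset.univ.biUnion A := by
    intro A
    ext y
    simp only [Finset.mem_biUnion, Finset.mem_univ, true_and]
    exact e.exists_congr_left.trans (by simp)
  refine ⟨hg, hgS, fun j => (e j).elim t fun _ => 2, fun j => (e j).elim t' fun _ => 2,
    fun j => (e j).elim f fun z => P z.1 z.2, fun j => (e j).elim f' fun z => P' z.1 z.2,
    ?_, ?_, ?_, ?_, ?_, ?_, ?_⟩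
  · intro j
    dsimp only
    rcases e j with _ | z
    exacts [hf, hP z.1 z.2]
  · intro j
    dsimp only
    rcases e j with _ | z
    exacts [hf', hP' z.1 z.2]
  · intro j j' hj
    simp only [hverts]
    exact d1 _ _ (e.injective.ne hj)
  · intro j j' hj
    simp only [hverts]
    exact d2 _ _ (e.injective.ne hj)
  · intro j
    dsimp only
    rcases e j with _ | z
    exacts [⟨hbeg, hend⟩, hends z.1 z.2]
  · simp only [hverts]
    rw [hbi (fun o => o.elim _ _), un2, hunion']
  · simp only [hverts]
    rw [hbi (fun o => o.elim _ _), un1, hunion]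

theorem reachable_tuples_card_ge {n k l : ℕ} {H : Finset (Finset (Fin n))} {β : ℝ} {i : ℕ}
    {u v : Fin n} (h : Reachable n k l H β i u v) :
    β * (n : ℝ) ^ ((2 * k - l) * i - 1) ≤
      Nat.card {t : Fin ((2 * k - l) * i - 1) → Fin n //
        ReachSet n k l i H u v (Finset.univ.image t)} := by
  refine h.trans (Nat.cast_le.mpr ?_)
  have himg : ∀ (d : ℕ) (T : Finset (Fin n)) (hT : T.card = d),
      Finset.univ.image (T.orderEmbOfFin hT) = T := by
    intro d T hT
    apply Finset.coe_injective
    rw [Finset.coe_image, Finset.coe_univ, Set.image_univ, Finset.range_orderEmbOfFin]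
  refine Nat.card_le_card_of_injective
    (fun T => ⟨T.1.orderEmbOfFin T.2.1, by rw [himg]; exact T.2.2⟩) ?_
  rintro ⟨T, hT⟩ ⟨T', hT'⟩ heq
  simp only [Subtype.mk.injEq] at heq ⊢
  rw [← himg _ T hT.1, ← himg _ T' hT'.1, heq]

theorem card_arrangements_ge {n k a : ℕ} (H : Finset (Finset (Fin n)))
    (V₁ V₂ U : Finset (Fin n)) (hpart : V₁ ∪ V₂ ∪ U = Finset.univ) (A : Finset (Fin k))
    (hA : A.card = a) :
    Nat.card {e : Finset (Fin n) // e ∈ H ∧ Disjoint e U ∧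
        (e ∩ V₁).card = a ∧ (e ∩ V₂).card = k - a} ≤
      Nat.card {x : Fin k → Fin n // Finset.univ.image x ∈ H ∧
        ∀ j, (j ∈ A → x j ∈ V₁) ∧ (j ∉ A → x j ∈ V₂)} := by
  classical
  have hex : ∀ e : {e : Finset (Fin n) // e ∈ H ∧ Disjoint e U ∧
        (e ∩ V₁).card = a ∧ (e ∩ V₂).card = k - a},
      ∃ x : {x : Fin k → Fin n // Finset.univ.image x ∈ H ∧
        ∀ j, (j ∈ A → x j ∈ V₁) ∧ (j ∉ A → x j ∈ V₂)}, Finset.univ.image x.1 = e.1 := by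
    rintro ⟨e, heH, heU, h1, h2⟩
    have e1 : {j // j ∈ A} ≃ {y // y ∈ e ∩ V₁} := Fintype.equivOfCardEq (by
      simp only [Fintype.card_coe, hA, h1])
    have e2 : {j // ¬ j ∈ A} ≃ {y // y ∈ e ∩ V₂} :=
      Fintype.equivOfCardEq (by
        rw [Fintype.card_subtype_compl]
        simp only [Fintype.card_fin, Fintype.card_coe, hA, h2])
    let x : Fin k → Fin n := fun j =>
      if h : j ∈ A then (e1 ⟨j, h⟩).1 else (e2 ⟨j, h⟩).1
    have x1 : ∀ j (h : j ∈ A), x j = (e1 ⟨j, h⟩).1 := fun j h => dif_pos h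
    have x2 : ∀ j (h : j ∉ A), x j = (e2 ⟨j, h⟩).1 := fun j h => dif_neg h
    have himg : Finset.univ.image x = e := by
      ext y
      simp only [Finset.mem_image, Finset.mem_univ, true_and]
      constructor
      · rintro ⟨j, rfl⟩
        by_cases h : j ∈ A
        · rw [x1 j h]; exact Finset.mem_of_mem_inter_left (e1 ⟨j, h⟩).2
        · rw [x2 j h]; exact Finset.mem_of_mem_inter_left (e2 ⟨j, h⟩).2
      · intro hy
        have hyU : y ∉ U := fun h => Finset.disjoint_left.mp heU hy h
        have hy' : y ∈ V₁ ∪ V₂ ∪ U := hpart ▸ Finset.mem_univ y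
        simp only [Finset.mem_union, hyU, or_false] at hy'
        rcases hy' with h | h
        · have hm := Finset.mem_inter.mpr ⟨hy, h⟩
          exact ⟨(e1.symm ⟨y, hm⟩).1, by rw [x1 _ (e1.symm ⟨y, hm⟩).2]; simp⟩
        · have hm := Finset.mem_inter.mpr ⟨hy, h⟩
          exact ⟨(e2.symm ⟨y, hm⟩).1, by rw [x2 _ (e2.symm ⟨y, hm⟩).2]; simp⟩
    refine ⟨⟨x, by rw [himg]; exact heH, fun j => ⟨fun h => ?_, fun h => ?_⟩⟩, himg⟩
    · rw [x1 j h]; exact Finset.mem_of_mem_inter_right (e1 ⟨j, h⟩).2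
    · rw [x2 j h]; exact Finset.mem_of_mem_inter_right (e2 ⟨j, h⟩).2
  choose x hx using hex
  refine Nat.card_le_card_of_injective x fun e e' h => ?_
  rw [Subtype.ext_iff, ← hx e, ← hx e', h]

theorem image_mem_of_partite_hom {n k : ℕ} {I : Type*} {H : Finset (Finset (Fin n))}
    {c : I → Fin k} {φ : I → Fin n}
    (hφ : ∀ σ : Fin k → I, (∀ j, c (σ j) = j) → Finset.univ.image (φ ∘ σ) ∈ H) (s : ℕ → I)
    (hs : Set.InjOn (fun i => c (s i)) (Set.Iio k)) :
    (Finset.range k).image (fun i => φ (s i)) ∈ H := by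
  have hinj : Function.Injective fun i : Fin k => c (s i) := fun x y h =>
    Fin.ext (hs x.2 y.2 h)
  let e := Equiv.ofBijective _ (Finite.injective_iff_bijective.mp hinj)
  have := hφ (fun j => s (e.symm j)) (fun j => e.apply_symm_apply j)
  convert this using 1
  ext y
  simp only [Finset.mem_image, Finset.mem_range, Finset.mem_univ, true_and, Function.comp]
  constructor
  · rintro ⟨i, hi, rfl⟩
    exact ⟨e ⟨i, hi⟩, by rw [e.symm_apply_apply]⟩
  · rintro ⟨j, rfl⟩
    exact ⟨e.symm j, (e.symm j).2, rfl⟩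

/-- The values `Γ (inl x)` carry an `l`-path with `l + 1` edges and, along `reroute`, one with `l`
edges; the positions `q i` missed by the latter are exchanged with `S` through reachable sets. -/
theorem isAbsorberTuple_of_partite_hom {n k l D b : ℕ} {H : Finset (Finset (Fin n))}
    {S : Finset (Fin n)} (hl : 1 ≤ l) (hlk : 2 * l < k)
    {Γ : Fin ((l + 1) * (k - l) + l) ⊕ (Fin (k - l) × Fin D) → Fin n}
    (hΓ : Function.Injective Γ) (hΓS : ∀ x, Γ x ∉ S)
    (c : Fin ((l + 1) * (k - l) + l) → Fin k) (hc : ∀ x, (c x : ℕ) = posColor l (k - l) x)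
    (hhom : ∀ σ : Fin k → Fin ((l + 1) * (k - l) + l), (∀ j, c (σ j) = j) →
      Finset.univ.image ((fun x => Γ (Sum.inl x)) ∘ σ) ∈ H)
    {u : Fin (k - l) → Fin n} (hu : Function.Injective u) (huS : Finset.univ.image u = S)
    {q : Fin (k - l) → Fin ((l + 1) * (k - l) + l)} (hq : Function.Injective q)
    (hqout : ∀ x, (∃ i, q i = x) ↔ ∀ p < l * (k - l) + l, reroute l (k - l) p ≠ x)
    (hreach : ∀ i, ReachSet n k l 2 H (u i) (Γ (Sum.inl (q i)))
      (Finset.univ.image fun d => Γ (Sum.inr (i, d))))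
    (e : Fin b ≃ Fin ((l + 1) * (k - l) + l) ⊕ (Fin (k - l) × Fin D)) :
    IsAbsorberTuple n k l b H S fun x => Γ (e x) := by
  have hM : l < k - l := by omega
  have hkM : k - l + l = k := by omega
  have hr : 0 < (l + 1) * (k - l) + l := by omega
  have hmaps := reroute_mapsTo hM
  have hinjr := reroute_injOn hM
  let ψ : ℕ → Fin ((l + 1) * (k - l) + l) := fun p => ⟨p % _, Nat.mod_lt p hr⟩
  have hψ : ∀ p, p < (l + 1) * (k - l) + l → (ψ p : ℕ) = p := fun p hp => Nat.mod_eq_of_lt hp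
  have hψr : ∀ p, p < l * (k - l) + l → (ψ (reroute l (k - l) p) : ℕ) = reroute l (k - l) p :=
    fun p hp => hψ _ (hmaps hp)
  have hin : ∀ {j t i}, j < t → i < k → j * (k - l) + i < t * (k - l) + l := by
    intro j t i hj hi
    have := Nat.mul_le_mul_right (k - l) (show j + 1 ≤ t from hj)
    rw [add_mul] at this
    omega
  have hinl : ∀ {x y}, Γ (Sum.inl x) = Γ (Sum.inl y) ↔ x = y := fun {x y} =>
    hΓ.eq_iff.trans Sum.inl_injective.eq_iff
  have hinr : ∀ {x y}, Γ (Sum.inr x) = Γ (Sum.inr y) ↔ x = y := fun {x y} =>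
    hΓ.eq_iff.trans Sum.inr_injective.eq_iff
  have hlr : ∀ {x y}, Γ (Sum.inl x) ≠ Γ (Sum.inr y) := fun {x y} h => by simpa using hΓ h
  have huΓ : ∀ {i x}, u i ≠ Γ x := fun {i x} h => hΓS x (h ▸ huS ▸ by simp)
  have hverts : pathVerts n k l (l + 1) (fun p => Γ (Sum.inl (ψ p))) =
      Finset.univ.image fun x => Γ (Sum.inl x) := by
    ext y
    simp only [pathVerts, Finset.mem_image, Finset.mem_range, Finset.mem_univ, true_and]
    constructor
    · rintro ⟨p, _, rfl⟩
      exact ⟨_, rfl⟩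
    · rintro ⟨x, rfl⟩
      exact ⟨x, x.2, by rw [show ψ x = x from Fin.ext (hψ x x.2)]⟩
  have hverts' : pathVerts n k l l (fun p => Γ (Sum.inl (ψ (reroute l (k - l) p)))) =
      (Finset.univ.filter fun x => ¬ ∃ i, q i = x).image fun x => Γ (Sum.inl x) := by
    ext y
    simp only [pathVerts, Finset.mem_image, Finset.mem_range, Finset.mem_univ, true_and,
      Finset.mem_filter, hqout]
    push Not
    constructor
    · rintro ⟨p, hp, rfl⟩
      exact ⟨_, ⟨p, hp, (hψr p hp).symm⟩, rfl⟩
    · rintro ⟨x, ⟨p, hp, hpx⟩, rfl⟩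
      refine ⟨p, hp, ?_⟩
      rw [show ψ (reroute l (k - l) p) = x from Fin.ext ((hψr p hp).trans hpx)]
  refine isAbsorberTuple_of_reachSets (by omega) (hΓ.comp e.injective) (fun i => hΓS _) hreach
    (f := fun p => Γ (Sum.inl (ψ p))) (f' := fun p => Γ (Sum.inl (ψ (reroute l (k - l) p))))
    (t := l + 1) (t' := l) ⟨?_, ?_⟩ ⟨?_, ?_⟩ ?_ ?_ ?_ ?_ ?_ ?_ ?_ ?_
  · intro x hx y hy hxy
    have := congrArg Fin.val (hinl.mp hxy)
    rwa [hψ x hx, hψ y hy] at this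
  · intro j hj
    refine image_mem_of_partite_hom hhom (fun i => ψ (j * (k - l) + i)) ?_
    intro x hx y hy hxy
    have := congrArg Fin.val hxy
    simp only [hc] at this
    rw [hψ _ (hin hj hx), hψ _ (hin hj hy)] at this
    exact posColor_injOn hM j (by rwa [hkM]) (by rwa [hkM]) this
  · intro x hx y hy hxy
    have := congrArg Fin.val (hinl.mp hxy)
    rw [hψr x hx, hψr y hy] at this
    exact hinjr hx hy this
  · intro j hj
    refine image_mem_of_partite_hom hhom (fun i => ψ (reroute l (k - l) (j * (k - l) + i))) ?_
    intro x hx y hy hxy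
    have := congrArg Fin.val hxy
    simp only [hc] at this
    rw [hψr _ (hin hj hx), hψr _ (hin hj hy)] at this
    exact posColor_reroute_injOn hM j (by rwa [hkM]) (by rwa [hkM]) this
  · funext i
    simp only [pathBeg]
    rw [reroute_beg hM i.2]
  · funext i
    simp only [pathEnd]
    rw [reroute_end hM i.2]
  · intro i i' hi
    simp only [Finset.disjoint_left, Finset.mem_insert, Finset.mem_image, Finset.mem_univ,
      true_and]
    rintro y (rfl | ⟨d, rfl⟩) (h | ⟨d', h⟩)
    · exact hi (hu h)
    · exact huΓ h.symm
    · exact huΓ h.symm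
    · exact hi (congrArg Prod.fst (hinr.mp h)).symm
  · intro i i' hi
    simp only [Finset.disjoint_left, Finset.mem_insert, Finset.mem_image, Finset.mem_univ,
      true_and]
    rintro y (rfl | ⟨d, rfl⟩) (h | ⟨d', h⟩)
    · exact hi (hq (hinl.mp h))
    · exact hlr h.symm
    · exact hlr h.symm
    · exact hi (congrArg Prod.fst (hinr.mp h)).symm
  · intro i
    rw [hverts]
    simp only [Finset.disjoint_left, Finset.mem_insert, Finset.mem_image, Finset.mem_univ,
      true_and]
    rintro y ⟨x, rfl⟩ (h | ⟨d', h⟩)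
    · exact huΓ h.symm
    · exact hlr h.symm
  · intro i
    rw [hverts']
    simp only [Finset.disjoint_left, Finset.mem_insert, Finset.mem_image, Finset.mem_univ,
      true_and, Finset.mem_filter]
    rintro y ⟨x, hx, rfl⟩ (h | ⟨d', h⟩)
    · exact hx ⟨i, (hinl.mp h).symm⟩
    · exact hlr h.symm
  · rw [hverts']
    ext y
    simp only [Finset.mem_union, Finset.mem_image, Finset.mem_filter, Finset.mem_univ, true_and,
      Finset.mem_biUnion, Finset.mem_insert]
    constructor
    · rintro (⟨x, _, rfl⟩ | ⟨i, rfl | ⟨d, rfl⟩⟩)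
      exacts [⟨e.symm (Sum.inl x), by simp⟩, ⟨e.symm (Sum.inl (q i)), by simp⟩,
        ⟨e.symm (Sum.inr (i, d)), by simp⟩]
    · rintro ⟨x, rfl⟩
      rcases e x with x | ⟨i, d⟩
      · by_cases hx : ∃ i, q i = x
        · obtain ⟨i, rfl⟩ := hx
          exact Or.inr ⟨i, Or.inl rfl⟩
        · exact Or.inl ⟨x, hx, rfl⟩
      · exact Or.inr ⟨i, Or.inr ⟨d, rfl⟩⟩
  · rw [hverts, ← huS]
    ext y
    simp only [Finset.mem_union, Finset.mem_image, Finset.mem_univ, true_and,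
      Finset.mem_biUnion, Finset.mem_insert]
    constructor
    · rintro (⟨x, rfl⟩ | ⟨i, rfl | ⟨d, rfl⟩⟩)
      exacts [Or.inl ⟨e.symm (Sum.inl x), by simp⟩, Or.inr ⟨i, rfl⟩,
        Or.inl ⟨e.symm (Sum.inr (i, d)), by simp⟩]
    · rintro (⟨x, rfl⟩ | ⟨i, rfl⟩)
      · rcases e x with x | ⟨i, d⟩
        · exact Or.inl ⟨x, rfl⟩
        · exact Or.inr ⟨i, Or.inr ⟨d, rfl⟩⟩
      · exact Or.inr ⟨i, Or.inl rfl⟩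

theorem exists_leftover_enumeration {l M : ℕ} (h : l < M) :
    ∃ q : Fin M → Fin ((l + 1) * M + l), Function.Injective q ∧
      ∀ x, (∃ i, q i = x) ↔ ∀ p < l * M + l, reroute l M p ≠ x := by
  classical
  let L : Finset (Fin ((l + 1) * M + l)) :=
    Finset.univ.filter fun x => ∀ p < l * M + l, reroute l M p ≠ x
  have hL : L.card = M := by
    let h' : Fin (l * M + l) → Fin ((l + 1) * M + l) := fun p =>
      ⟨reroute l M p, reroute_mapsTo h p.2⟩
    have hinj : Function.Injective h' := fun x y hxy =>
      Fin.ext (reroute_injOn h x.2 y.2 (congrArg Fin.val hxy))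
    have hcompl : L = (Finset.univ.image h')ᶜ := by
      ext x
      simp only [L, h', Finset.mem_filter, Finset.mem_univ, true_and, Finset.mem_compl,
        Finset.mem_image, not_exists, Fin.ext_iff]
      exact ⟨fun hx p => hx p p.2, fun hx p hp => hx ⟨p, hp⟩⟩
    rw [hcompl, Finset.card_compl, Finset.card_image_of_injective _ hinj]
    simp only [Fintype.card_fin, Finset.card_univ, add_mul]
    omega
  refine ⟨L.orderEmbOfFin hL, (L.orderEmbOfFin hL).injective, fun x => ?_⟩
  rw [← Set.mem_range, Finset.range_orderEmbOfFin]
  simp [L]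

theorem exists_color_class {k M l a : ℕ} (hkM : M + l = k) {f : Fin M → Fin k}
    (hf : Function.Injective f) (B : Finset (Fin M)) (h1 : B.card ≤ a) (h2 : a ≤ B.card + l) :
    ∃ A : Finset (Fin k), A.card = a ∧ ∀ i, f i ∈ A ↔ i ∈ B := by
  classical
  have hdisj : Disjoint (B.image f) (Finset.univ.image f)ᶜ :=
    disjoint_compl_right.mono_left (Finset.image_subset_image (Finset.subset_univ B))
  have hB := Finset.card_image_of_injective B hf
  obtain ⟨A, hA1, hA2, hA⟩ := Finset.exists_subsuperset_card_eq (n := a)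
    (Finset.subset_union_left (s₁ := B.image f) (s₂ := (Finset.univ.image f)ᶜ)) (by rw [hB]; exact h1)
    (by
      rw [Finset.card_union_of_disjoint hdisj, hB, Finset.card_compl,
        Finset.card_image_of_injective _ hf, Finset.card_univ, Fintype.card_fin, Fintype.card_fin]
      omega)
  refine ⟨A, hA, fun i => ⟨fun hi => ?_, fun hi => hA1 (Finset.mem_image_of_mem f hi)⟩⟩
  have := hA2 hi
  simp only [Finset.mem_union, Finset.mem_compl, Finset.mem_image, Finset.mem_univ, true_and,
    exists_apply_eq_apply, not_true_eq_false, or_false] at this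
  obtain ⟨i', hi', h⟩ := this
  exact hf h ▸ hi'

theorem card_sigma_pi_ge {α β ι : Type*} [Finite α] [Finite β] [Fintype ι] (P : α → Prop)
    (Q : α → ι → β → Prop) {x y : ℝ} (hy : 0 ≤ y) (hP : x ≤ Nat.card {a // P a})
    (hQ : ∀ a, P a → ∀ i, y ≤ Nat.card {b // Q a i b}) :
    x * y ^ Fintype.card ι ≤
      Nat.card {z : α × (ι → β) // P z.1 ∧ ∀ i, Q z.1 i (z.2 i)} := by
  classical
  have := Fintype.ofFinite α
  let e : {z : α × (ι → β) // P z.1 ∧ ∀ i, Q z.1 i (z.2 i)} ≃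
      Σ a : {a // P a}, ∀ i, {b // Q a.1 i b} :=
    { toFun := fun z => ⟨⟨z.1.1, z.2.1⟩, fun i => ⟨z.1.2 i, z.2.2 i⟩⟩
      invFun := fun w => ⟨(w.1.1, fun i => (w.2 i).1), w.1.2, fun i => (w.2 i).2⟩
      left_inv := fun _ => rfl
      right_inv := fun _ => rfl }
  rw [Nat.card_congr e, Nat.card_sigma]
  simp only [Nat.card_pi]
  push_cast
  calc x * y ^ Fintype.card ι ≤ Nat.card {a // P a} * y ^ Fintype.card ι :=
        mul_le_mul_of_nonneg_right hP (by positivity)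
    _ = ∑ _a : {a // P a}, ∏ _i : ι, y := by
        simp [Nat.card_eq_fintype_card]
    _ ≤ _ := Finset.sum_le_sum fun a _ =>
        Finset.prod_le_prod (fun _ _ => hy) fun i _ => hQ a.1 a.2 i

theorem absorber_count_ge {n k l a s r D b : ℕ} {H : Finset (Finset (Fin n))}
    {V₁ V₂ U S : Finset (Fin n)} {β μ : ℝ} (hl : 1 ≤ l) (hlk : 2 * l < k) (hn : 0 < n)
    (hβ : 0 ≤ β) (hβ1 : β ≤ 1) (hμ : 0 ≤ μ) (hV : Disjoint V₁ V₂)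
    (hpart : V₁ ∪ V₂ ∪ U = Finset.univ)
    (h1 : ∀ u ∈ V₁, ∀ v ∈ V₁, u ≠ v → Reachable n k l H β 2 u v)
    (h2 : ∀ u ∈ V₂, ∀ v ∈ V₂, u ≠ v → Reachable n k l H β 2 u v)
    (hrobust : μ * (n : ℝ) ^ k ≤
      (Nat.card {e : Finset (Fin n) // e ∈ H ∧ Disjoint e U ∧
        (e ∩ V₁).card = a ∧ (e ∩ V₂).card = k - a} : ℝ))
    (hr : r = (l + 1) * (k - l) + l) (hD : D = (2 * k - l) * 2 - 1)
    (hb : b = r + (k - l) * D) (hsa : s ≤ a) (has : a ≤ s + l)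
    (hS : S.card = k - l) (hS1 : (S ∩ V₁).card = s) (hS2 : (S ∩ V₂).card = k - l - s)
    (hsS : s ≤ k - l) :
    μ ^ (r ^ k) * β ^ (k - l) * (n : ℝ) ^ b -
        (b ^ 2 + b * (k - l : ℕ)) * (n : ℝ) ^ (b - 1) ≤
      (Nat.card {g : Fin b → Fin n // IsAbsorberTuple n k l b H S g} : ℝ) := by
  classical
  subst hr hD
  have hM : l < k - l := by omega
  have hkM : k - l + l = k := by omega
  have : Nonempty (Fin n) := ⟨⟨0, hn⟩⟩
  let r := (l + 1) * (k - l) + l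
  let D := (2 * k - l) * 2 - 1
  obtain ⟨q, hq, hqout⟩ := exists_leftover_enumeration hM
  let c : Fin r → Fin k := fun x => ⟨posColor l (k - l) x, (posColor_lt hM x).trans_eq hkM⟩
  have hcq : Function.Injective (c ∘ q) := fun i i' h => hq (Fin.ext
    (posColor_leftover_injOn hM ⟨(q i).2, (hqout _).mp ⟨i, rfl⟩⟩
      ⟨(q i').2, (hqout _).mp ⟨i', rfl⟩⟩ (congrArg Fin.val h)))
  have hsec : ∃ σ₀ : Fin k → Fin r, ∀ j, c (σ₀ j) = j := by
    have hkr : k ≤ r := by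
      have : 1 * (k - l) ≤ (l + 1) * (k - l) := Nat.mul_le_mul_right _ (by omega)
      omega
    have hinj : Function.Injective fun i : Fin k => c (Fin.castLE hkr i) := by
      intro x y hxy
      have := congrArg Fin.val hxy
      exact Fin.ext (posColor_injOn hM 0 (by simp [hkM]) (by simp [hkM]) (by simpa [c] using this))
    choose τ hτ using (Finite.injective_iff_surjective.mp hinj)
    exact ⟨fun j => Fin.castLE hkr (τ j), hτ⟩
  obtain ⟨σ₀, hσ₀⟩ := hsec
  let u : Fin (k - l) → Fin n := S.orderEmbOfFin hS
  have hu : Function.Injective u := (S.orderEmbOfFin hS).injective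
  have huS : Finset.univ.image u = S := by
    apply Finset.coe_injective
    rw [Finset.coe_image, Finset.coe_univ, Set.image_univ, Finset.range_orderEmbOfFin]
  let B : Finset (Fin (k - l)) := Finset.univ.filter fun i => u i ∈ V₁
  have hB : B.card = s := by
    rw [← hS1, ← Finset.card_image_of_injective B hu]
    congr 1
    ext y
    simp only [B, Finset.mem_image, Finset.mem_filter, Finset.mem_univ, true_and,
      Finset.mem_inter, ← huS]
    constructor
    · rintro ⟨i, hi, rfl⟩
      exact ⟨⟨i, rfl⟩, hi⟩
    · rintro ⟨⟨i, rfl⟩, hi⟩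
      exact ⟨i, hi, rfl⟩
  have hSV : ∀ i, u i ∉ V₁ → u i ∈ V₂ := by
    have hsub : S ∩ (V₁ ∪ V₂) = S := by
      apply Finset.eq_of_subset_of_card_le Finset.inter_subset_left
      rw [Finset.inter_union_distrib_left, Finset.card_union_of_disjoint
        (hV.mono Finset.inter_subset_right Finset.inter_subset_right)]
      omega
    intro i hi
    have : u i ∈ S ∩ (V₁ ∪ V₂) := by
      rw [hsub, ← huS]
      exact Finset.mem_image_of_mem u (Finset.mem_univ i)
    simpa [hi] using (Finset.mem_inter.mp this).2
  obtain ⟨A, hA, hAB⟩ := exists_color_class (a := a) hkM hcq B (by omega) (by omega)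
  let R : (Fin k → Fin n) → Prop := fun x => Finset.univ.image x ∈ H ∧
    ∀ j, (j ∈ A → x j ∈ V₁) ∧ (j ∉ A → x j ∈ V₂)
  let P : (Fin r → Fin n) → Prop := fun φ => ∀ σ : Fin k → Fin r, (∀ j, c (σ j) = j) → R (φ ∘ σ)
  let Q : (Fin r → Fin n) → Fin (k - l) → (Fin D → Fin n) → Prop := fun φ i t =>
    u i ≠ φ (q i) → ReachSet n k l 2 H (u i) (φ (q i)) (Finset.univ.image t)
  have hP : μ ^ (r ^ k) * (n : ℝ) ^ r ≤ Nat.card {φ // P φ} := by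
    have := card_partite_homs_ge (X := Fin n) c R hμ (by
      rw [Fintype.card_fin]
      exact hrobust.trans (Nat.cast_le.mpr (card_arrangements_ge H V₁ V₂ U hpart A hA)))
    simpa only [Fintype.card_fin] using this
  have hQ : ∀ φ, P φ → ∀ i, β * (n : ℝ) ^ D ≤ Nat.card {t // Q φ i t} := by
    intro φ hφ i
    by_cases hui : u i = φ (q i)
    · have : Nat.card {t // Q φ i t} = n ^ D := by
        rw [Nat.card_congr (Equiv.subtypeUnivEquiv fun t h => absurd hui h), Nat.card_fun]
        simp
      rw [this]
      push_cast
      exact mul_le_of_le_one_left (by positivity) hβ1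
    · have hmem := (hφ (Function.update σ₀ (c (q i)) (q i)) (fun j => by
        by_cases hj : j = c (q i)
        · rw [hj, Function.update_self]
        · rw [Function.update_of_ne hj, hσ₀])).2 (c (q i))
      simp only [Function.comp_apply, Function.update_self] at hmem
      have hi : c (q i) ∈ A ↔ u i ∈ V₁ := by
        rw [← Function.comp_apply (f := c), hAB]
        simp [B]
      have hreach : Reachable n k l H β 2 (u i) (φ (q i)) := by
        by_cases huV : u i ∈ V₁
        · exact h1 _ huV _ (hmem.1 (hi.mpr huV)) hui
        · exact h2 _ (hSV i huV) _ (hmem.2 fun h => huV (hi.mp h)) hui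
      refine (reachable_tuples_card_ge hreach).trans (le_of_eq ?_)
      congr 1
      exact Nat.card_congr (Equiv.subtypeEquivRight fun t => ⟨fun h _ => h, fun h => h hui⟩)
  have hcount := card_sigma_pi_ge P Q (by positivity) hP hQ
  have e : Fin b ≃ Fin r ⊕ (Fin (k - l) × Fin D) :=
    Fintype.equivOfCardEq (by simp [hb, r, D])
  let E : (Fin b → Fin n) ≃ (Fin r → Fin n) × (Fin (k - l) → Fin D → Fin n) :=
    (Equiv.arrowCongr e (Equiv.refl _)).trans ((Equiv.sumArrowEquivProdArrow _ _ _).trans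
      (Equiv.prodCongr (Equiv.refl _) (Equiv.curry _ _ _)))
  have hgood : Nat.card {z : (Fin r → Fin n) × (Fin (k - l) → Fin D → Fin n) //
        P z.1 ∧ ∀ i, Q z.1 i (z.2 i)} ≤
      Nat.card {g : Fin b → Fin n // IsAbsorberTuple n k l b H S g} +
      Nat.card {g : Fin b → Fin n // ¬ (Function.Injective g ∧ ∀ i, g i ∉ S)} := by
    rw [Nat.card_congr (Equiv.subtypeEquiv E
      (p := fun g => P (E g).1 ∧ ∀ i, Q (E g).1 i ((E g).2 i)) fun _ => Iff.rfl).symm]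
    simp only [Nat.card_eq_fintype_card, Fintype.card_subtype]
    refine (Finset.card_le_card fun g hg => ?_).trans (Finset.card_union_le _ _)
    simp only [Finset.mem_filter, Finset.mem_univ, true_and, Finset.mem_union] at hg ⊢
    by_cases hgi : Function.Injective g ∧ ∀ i, g i ∉ S
    · left
      have key := isAbsorberTuple_of_partite_hom (H := H) (S := S) (Γ := g ∘ e.symm) hl hlk
        (hgi.1.comp e.symm.injective) (fun x => hgi.2 _) c (fun _ => rfl)
        (fun σ hσ => (hg.1 σ hσ).1) hu huS hq hqout (fun i => hg.2 i fun h => ?_) e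
      · simpa using key
      · exact hgi.2 (e.symm (Sum.inl (q i))) (by
          have : u i = g (e.symm (Sum.inl (q i))) := h
          rw [← this, ← huS]
          exact Finset.mem_image_of_mem u (Finset.mem_univ i))
    · exact Or.inr hgi
  have hbad := card_not_injective_or_meets_le (ι := Fin b) S
  simp only [Fintype.card_fin, hS] at hbad hcount
  have hgood' : (Nat.card {z : (Fin r → Fin n) × (Fin (k - l) → Fin D → Fin n) //
        P z.1 ∧ ∀ i, Q z.1 i (z.2 i)} : ℝ) ≤
      Nat.card {g : Fin b → Fin n // IsAbsorberTuple n k l b H S g} +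
      (b ^ 2 + b * (k - l : ℕ)) * (n : ℝ) ^ (b - 1) := by
    exact_mod_cast hgood.trans (Nat.add_le_add_left hbad _)
  have heq : μ ^ (r ^ k) * (n : ℝ) ^ r * (β * (n : ℝ) ^ D) ^ (k - l) =
      μ ^ (r ^ k) * β ^ (k - l) * (n : ℝ) ^ b := by
    rw [hb, pow_add, mul_pow, ← pow_mul, mul_comm D]
    ring
  rw [heq] at hcount
  exact sub_le_iff_le_add.mpr (hcount.trans hgood')

/-- For `k ≥ 3`, `1 ≤ ℓ < k/2` and constants `1/n ≪ β ≪ μ ≪ 1/k`: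
if `{V₁, V₂, U}` is a partition of `V(H)` with `V₁, V₂` each `(β, 2)`-closed in `H`, and
`(a, k-a)` is a `μ`-robust edge-vector of `H - U` for some `1 ≤ a ≤ k-1`, then (with
`m := a` if `a ≤ k/2` and `m := a - ℓ + 1` otherwise) there is `b = (4k-2ℓ-1)(k-ℓ) + r`,
`r ≤ k⁴`, such that every `(k-ℓ)`-set `S` with index vector `(m, k-ℓ-m)` or
`(m-1, k-ℓ-m+1)` has at least `β^{k-ℓ+1} n^b / 2` `S`-absorbers, each a `b`-tuple of
distinct vertices avoiding `S` spanning `2k-2ℓ+1` vertex-disjoint `ℓ`-paths. -/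
theorem many_absorbers (k l : ℕ) (hk : 3 ≤ k) (hl1 : 1 ≤ l) (hlk : 2 * l < k) :
    ∃ μ₀ : ℝ, 0 < μ₀ ∧ ∀ μ : ℝ, 0 < μ → μ ≤ μ₀ →
    ∃ β₀ : ℝ, 0 < β₀ ∧ ∀ β : ℝ, 0 < β → β ≤ β₀ →
    ∃ n₀ : ℕ, ∀ n : ℕ, n₀ ≤ n →
      ∀ H : Finset (Finset (Fin n)), IsKGraph n k H →
        ∀ V₁ V₂ U : Finset (Fin n),
          Disjoint V₁ V₂ → Disjoint V₁ U → Disjoint V₂ U → V₁ ∪ V₂ ∪ U = Finset.univ →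
          (∀ u ∈ V₁, ∀ v ∈ V₁, u ≠ v → Reachable n k l H β 2 u v) →
          (∀ u ∈ V₂, ∀ v ∈ V₂, u ≠ v → Reachable n k l H β 2 u v) →
          ∀ a : ℕ, 1 ≤ a → a ≤ k - 1 →
            μ * (n : ℝ) ^ k ≤
              (Nat.card {e : Finset (Fin n) // e ∈ H ∧ Disjoint e U ∧
                (e ∩ V₁).card = a ∧ (e ∩ V₂).card = k - a} : ℝ) →
            ∃ r : ℕ, r ≤ k ^ 4 ∧
              ∀ b : ℕ, b = (4 * k - 2 * l - 1) * (k - l) + r →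
                ∀ m : ℕ, m = (if 2 * a ≤ k then a else a - l + 1) →
                  ∀ S : Finset (Fin n), S.card = k - l →
                    (((S ∩ V₁).card = m ∧ (S ∩ V₂).card = k - l - m) ∨
                      ((S ∩ V₁).card = m - 1 ∧ (S ∩ V₂).card = k - l - m + 1)) →
                    β ^ (k - l + 1) * (n : ℝ) ^ b / 2 ≤
                      (Nat.card {g : Fin b → Fin n // IsAbsorberTuple n k l b H S g} : ℝ) := by
  refine ⟨1, one_pos, fun μ hμ _ => ?_⟩
  let r := (l + 1) * (k - l) + l
  let b₀ := r + (k - l) * ((2 * k - l) * 2 - 1)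
  let C : ℝ := b₀ ^ 2 + b₀ * (k - l : ℕ)
  refine ⟨min 1 (μ ^ r ^ k), by positivity, fun β hβ hβ' => ?_⟩
  have hβ1 := hβ'.trans (min_le_left _ _)
  have hβμ := hβ'.trans (min_le_right _ _)
  refine ⟨⌈2 * C / β ^ (k - l + 1)⌉₊ + 1, ?_⟩
  intro n hn H _ V₁ V₂ U h12 _ _ hpart h1 h2 a ha1 hak hrobust
  refine ⟨r, ?_, ?_⟩
  · have e1 : (l + 1) * (k - l) ≤ k * k := Nat.mul_le_mul (by omega) (by omega)
    calc r ≤ k * k + k := Nat.add_le_add e1 (by omega)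
      _ ≤ k * k * 2 := by nlinarith
      _ ≤ k * k * (k * k) := Nat.mul_le_mul_left _ (by nlinarith)
      _ = k ^ 4 := by ring
  intro b hb m hm S hS hSm
  have hb₀ : b = b₀ := by
    rw [hb, mul_comm, add_comm]
    congr 2
    omega
  have hbpos : b = b - 1 + 1 := by
    have : 1 ≤ r := Nat.le_add_left_of_le hl1
    omega
  obtain ⟨s, hsa, has, hS1, hS2, hsS⟩ : ∃ s, s ≤ a ∧ a ≤ s + l ∧ (S ∩ V₁).card = s ∧
      (S ∩ V₂).card = k - l - s ∧ s ≤ k - l := by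
    split_ifs at hm with h <;> rcases hSm with ⟨h3, h4⟩ | ⟨h3, h4⟩ <;>
      exact ⟨_, by omega, by omega, h3, by omega, by omega⟩
  have hmain := absorber_count_ge hl1 hlk (by omega) hβ.le hβ1 hμ.le h12 hpart h1 h2 hrobust
    rfl rfl hb₀ hsa has hS hS1 hS2 hsS
  refine le_trans ?_ hmain
  have hn' : 2 * C / β ^ (k - l + 1) ≤ n :=
    (Nat.le_ceil _).trans (Nat.cast_le.mpr (by omega))
  rw [div_le_iff₀ (by positivity)] at hn'
  have hpow : (n : ℝ) ^ b = n ^ (b - 1) * n := by rw [← pow_succ, ← hbpos]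
  have hlow : β ^ (k - l + 1) * (n : ℝ) ^ b ≤ μ ^ r ^ k * β ^ (k - l) * (n : ℝ) ^ b := by
    rw [pow_succ']
    gcongr
  have hbad : C * (n : ℝ) ^ (b - 1) ≤ β ^ (k - l + 1) * (n : ℝ) ^ b / 2 := by
    have := mul_le_mul_of_nonneg_left hn' (show (0 : ℝ) ≤ (n : ℝ) ^ (b - 1) by positivity)
    rw [hpow]
    linarith
  have hC : ((b : ℝ) ^ 2 + b * (k - l : ℕ)) = C := by rw [hb₀]
  rw [hC]
  linarith
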